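/- Let S be a finitary congruential logic, A an S-algebra and F an optimal S-base, with φ the representation map relative to F. The map sending an S-filter F₀ of A to ⟦φ[F₀]⟧, the filter of M(A) generated by {φ(a) : a ∈ F₀}, is a lattice isomorphism from Fi_S(A) onto Fi(M(A)), whose inverse sends a filter G of M(A) to φ⁻¹[G] = {a ∈ A : φ(a) ∈ G}. -/

import Mathlib

/-- An algebraic language: a type of function symbols with finite arities. -/
structure Lang where
  F : Type
  ar : F → ℕ

/-- An algebra for the language `L` on the carrier `A`. -/
structure AlgStr (L : Lang) (A : Type) where
  op : ∀ f : L.F, (Fin (L.ar f) → A) → A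

/-- Formulas (terms) of `L` over countably many variables. -/
inductive Fm (L : Lang) : Type where
  | var : ℕ → Fm L
  | node : (f : L.F) → (Fin (L.ar f) → Fm L) → Fm L

/-- The absolutely free algebra of formulas (the term algebra). -/
def FmAlg (L : Lang) : AlgStr L (Fm L) := ⟨Fm.node⟩

/-- Homomorphisms of algebras. -/
def IsHom {L : Lang} {A B : Type} (SA : AlgStr L A) (SB : AlgStr L B) (h : A → B) : Prop :=
  ∀ (f : L.F) (args : Fin (L.ar f) → A), h (SA.op f args) = SB.op f fun i => h (args i)

/-- A logic (deductive system) in the language `L`: a substitution-invariant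
consequence relation on formulas. -/
structure Logic (L : Lang) where
  Thm : Set (Fm L) → Fm L → Prop
  refl : ∀ Γ γ, γ ∈ Γ → Thm Γ γ
  cut : ∀ Γ Δ δ, (∀ γ ∈ Γ, Thm Δ γ) → Thm Γ δ → Thm Δ δ
  subst_inv : ∀ Γ δ (σ : Fm L → Fm L), IsHom (FmAlg L) (FmAlg L) σ →
    Thm Γ δ → Thm (σ '' Γ) (σ δ)

variable {L : Lang} {A : Type}

/-- A logic has theorems when some formula follows from the empty set. -/
def HasTheorems (S : Logic L) : Prop := ∃ δ : Fm L, S.Thm ∅ δ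

/-- `S`-filters of an algebra. -/
def IsSFilter (S : Logic L) (SA : AlgStr L A) (F : Set A) : Prop :=
  ∀ h : Fm L → A, IsHom (FmAlg L) SA h →
    ∀ (Γ : Set (Fm L)) (δ : Fm L), S.Thm Γ δ → (∀ γ ∈ Γ, h γ ∈ F) → h δ ∈ F

/-- The `S`-filter generated by a subset. -/
def Fg (S : Logic L) (SA : AlgStr L A) (B : Set A) : Set A :=
  ⋂₀ {F | IsSFilter S SA F ∧ B ⊆ F}

/-- The specialization quasiorder of an algebra. -/
def SpecLe (S : Logic L) (SA : AlgStr L A) (a b : A) : Prop :=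
  Fg S SA {b} ⊆ Fg S SA {a}

/-- Congruences of an algebra. -/
def IsCongr (SA : AlgStr L A) (r : A → A → Prop) : Prop :=
  Equivalence r ∧ ∀ (f : L.F) (x y : Fin (L.ar f) → A),
    (∀ i, r (x i) (y i)) → r (SA.op f x) (SA.op f y)

/-- A logic is congruential when the specialization equivalence is a congruence
of every algebra. -/
def Congruential (S : Logic L) : Prop :=
  ∀ (A : Type) (SA : AlgStr L A),
    IsCongr SA fun a b => SpecLe S SA a b ∧ SpecLe S SA b a

/-- `S`-algebras: the identity is the only congruence below the specialization
equivalence. -/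
def IsSAlgebra (S : Logic L) (SA : AlgStr L A) : Prop :=
  ∀ r : A → A → Prop, IsCongr SA r →
    (∀ a b, r a b → SpecLe S SA a b ∧ SpecLe S SA b a) → ∀ a b, r a b → a = b

/-- Finitary logics. -/
def Finitary (S : Logic L) : Prop :=
  ∀ (Γ : Set (Fm L)) (δ : Fm L), S.Thm Γ δ →
    ∃ Γ₀ : Finset (Fm L), ↑Γ₀ ⊆ Γ ∧ S.Thm ↑Γ₀ δ

/-- Filter-distributive logics: the lattice of `S`-filters of every algebra is
distributive. -/
def FilterDistributive (S : Logic L) : Prop :=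
  ∀ (A : Type) (SA : AlgStr L A) (F G H : Set A),
    IsSFilter S SA F → IsSFilter S SA G → IsSFilter S SA H →
      F ∩ Fg S SA (G ∪ H) = Fg S SA ((F ∩ G) ∪ (F ∩ H))

/-- `S`-ideals. -/
def IsSIdeal (S : Logic L) (SA : AlgStr L A) (I : Set A) : Prop :=
  ∀ I' : Finset A, ↑I' ⊆ I → ∀ a : A,
    (⋂ b ∈ I', Fg S SA {b}) ⊆ Fg S SA {a} → a ∈ I

/-- The strong-ideal condition. -/
def StrongIdealCond (S : Logic L) (SA : AlgStr L A) (I : Set A) : Prop :=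
  ∀ I' : Finset A, ↑I' ⊆ I → ∀ B : Finset A, B.Nonempty →
    (⋂ b ∈ I', Fg S SA {b}) ⊆ Fg S SA ↑B → (Fg S SA ↑B ∩ I).Nonempty

/-- Strong `S`-ideals. -/
def IsStrongSIdeal (S : Logic L) (SA : AlgStr L A) (I : Set A) : Prop :=
  IsSIdeal S SA I ∧ StrongIdealCond S SA I

/-- Optimal `S`-filters. -/
def IsOptimalSFilter (S : Logic L) (SA : AlgStr L A) (F : Set A) : Prop :=
  IsSFilter S SA F ∧ ∃ I : Set A, IsStrongSIdeal S SA I ∧ F ∩ I = ∅ ∧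
    (∀ G, IsSFilter S SA G → G ∩ I = ∅ → F ⊆ G → G = F) ∧
    (∀ J, IsStrongSIdeal S SA J → F ∩ J = ∅ → I ⊆ J → J = I)

/-- Irreducible `S`-filters: meet-irreducible elements of the lattice of
`S`-filters. -/
def IsIrrSFilter (S : Logic L) (SA : AlgStr L A) (F : Set A) : Prop :=
  IsSFilter S SA F ∧ F ≠ Set.univ ∧
    ∀ G H, IsSFilter S SA G → IsSFilter S SA H → F = G ∩ H → F = G ∨ F = H

/-- Order ideals of the poset `(A, ≤)` given by the specialization order. -/
def IsSpecOrderIdeal (S : Logic L) (SA : AlgStr L A) (I : Set A) : Prop :=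
  I.Nonempty ∧ (∀ a ∈ I, ∀ b, SpecLe S SA b a → b ∈ I) ∧ DirectedOn (SpecLe S SA) I

/-- Bottom families. -/
def IsBottomFamily (S : Logic L) (SA : AlgStr L A) (U : Finset A) : Prop :=
  U.Nonempty ∧ (∀ a ∈ U, ∀ b ∈ U, a ≠ b → ¬ SpecLe S SA a b) ∧
    Fg S SA ↑U = Set.univ

/-- `S`-prime subsets. -/
def IsSPrime (S : Logic L) (SA : AlgStr L A) (X : Set A) : Prop :=
  X ≠ Set.univ ∧ ∀ B : Finset A, B.Nonempty →
    (Fg S SA ↑B ∩ X).Nonempty → ((↑B : Set A) ∩ X).Nonempty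

/-- Closure bases for the system of `S`-filters. -/
def IsClosureBase (S : Logic L) (SA : AlgStr L A) (𝓕 : Set (Set A)) : Prop :=
  (∀ P ∈ 𝓕, IsSFilter S SA P) ∧
    ∀ F, IsSFilter S SA F → F = ⋂₀ {P | P ∈ 𝓕 ∧ F ⊆ P}

/-- The representation map `φ` relative to a closure base. -/
def Phi (𝓕 : Set (Set A)) (a : A) : Set (Set A) := {P | P ∈ 𝓕 ∧ a ∈ P}

/-- The extension `φ̂` of the representation map to subsets. -/
def PhiHat (𝓕 : Set (Set A)) (B : Set A) : Set (Set A) := {P | P ∈ 𝓕 ∧ B ⊆ P}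

/-- The carrier of the `S`-semilattice `M(A)` relative to a closure base. -/
def MSet (𝓕 : Set (Set A)) : Set (Set (Set A)) :=
  {U | ∃ B : Finset A, U = PhiHat 𝓕 ↑B}

/-- Filters of the meet-semilattice with carrier `MA` (ordered by inclusion,
with meet the binary intersection). -/
def IsMFilter (MA G : Set (Set (Set A))) : Prop :=
  G ⊆ MA ∧ G.Nonempty ∧ (∀ U ∈ G, ∀ V ∈ MA, U ⊆ V → V ∈ G) ∧
    ∀ U ∈ G, ∀ V ∈ G, U ∩ V ∈ G

/-- The filter of the meet-semilattice `MA` generated by a subset. -/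
def MGen (MA X : Set (Set (Set A))) : Set (Set (Set A)) :=
  ⋂₀ {G | IsMFilter MA G ∧ X ⊆ G}

/-- Frink ideals of the meet-semilattice with carrier `MA`. -/
def IsMFrinkIdeal (MA J : Set (Set (Set A))) : Prop :=
  J ⊆ MA ∧ ∀ J' : Finset (Set (Set A)), ↑J' ⊆ J → ∀ b ∈ MA,
    (∀ c ∈ MA, (∀ a ∈ J', a ⊆ c) → b ⊆ c) → b ∈ J

/-- The Frink ideal of the meet-semilattice `MA` generated by a subset. -/
def MFrinkGen (MA X : Set (Set (Set A))) : Set (Set (Set A)) :=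
  ⋂₀ {J | IsMFrinkIdeal MA J ∧ X ⊆ J}

/-- `∧`-prime subsets of the meet-semilattice with carrier `MA`. -/
def IsMPrime (MA X : Set (Set (Set A))) : Prop :=
  X ⊆ MA ∧ X ≠ MA ∧ ∀ U : Finset (Set (Set A)), U.Nonempty → ↑U ⊆ MA →
    ⋂₀ ↑U ∈ X → ∃ u ∈ U, u ∈ X

/-- Optimal filters of the meet-semilattice with carrier `MA`. -/
def IsMOptFilter (MA F : Set (Set (Set A))) : Prop :=
  IsMFilter MA F ∧ ∃ I, IsMFrinkIdeal MA I ∧ F ∩ I = ∅ ∧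
    (∀ G, IsMFilter MA G → G ∩ I = ∅ → F ⊆ G → G = F) ∧
    (∀ J, IsMFrinkIdeal MA J → F ∩ J = ∅ → I ⊆ J → J = I)

theorem subset_Fg (S : Logic L) (SA : AlgStr L A) (B : Set A) : B ⊆ Fg S SA B :=
  fun _ hb _ hF => hF.2 hb

theorem Fg_subset {S : Logic L} {SA : AlgStr L A} {B F : Set A} (hF : IsSFilter S SA F)
    (h : B ⊆ F) : Fg S SA B ⊆ F :=
  fun _ ha => ha F ⟨hF, h⟩

theorem isSFilter_Fg (S : Logic L) (SA : AlgStr L A) (B : Set A) :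
    IsSFilter S SA (Fg S SA B) :=
  fun h hh Γ δ hd hΓ F hF => hF.1 h hh Γ δ hd fun γ hγ => hΓ γ hγ F hF

theorem mem_Fg_of_PhiHat_subset_Phi {S : Logic L} {SA : AlgStr L A} {𝓕 : Set (Set A)}
    (hbase : IsClosureBase S SA 𝓕) {B : Set A} {a : A} (h : PhiHat 𝓕 B ⊆ Phi 𝓕 a) :
    a ∈ Fg S SA B := by
  rw [hbase.2 _ (isSFilter_Fg S SA B)]
  rintro P ⟨hP, hBP⟩
  exact (h ⟨hP, (subset_Fg S SA B).trans hBP⟩).2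

theorem Phi_eq_PhiHat_singleton (𝓕 : Set (Set A)) (a : A) : Phi 𝓕 a = PhiHat 𝓕 {a} := by
  ext P
  simp [Phi, PhiHat]

theorem PhiHat_union (𝓕 : Set (Set A)) (B C : Set A) :
    PhiHat 𝓕 (B ∪ C) = PhiHat 𝓕 B ∩ PhiHat 𝓕 C := by
  ext P
  simp only [PhiHat, Set.union_subset_iff, Set.mem_inter_iff, Set.mem_ofPred_eq]
  tauto

theorem Phi_mem_MSet (𝓕 : Set (Set A)) (a : A) : Phi 𝓕 a ∈ MSet 𝓕 :=
  ⟨{a}, by rw [Phi_eq_PhiHat_singleton, Finset.coe_singleton]⟩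

open Classical in
theorem inter_mem_MSet {𝓕 : Set (Set A)} {U V : Set (Set A)} (hU : U ∈ MSet 𝓕)
    (hV : V ∈ MSet 𝓕) : U ∩ V ∈ MSet 𝓕 := by
  obtain ⟨B, rfl⟩ := hU
  obtain ⟨C, rfl⟩ := hV
  exact ⟨B ∪ C, by rw [Finset.coe_union, PhiHat_union]⟩

open Classical in
theorem PhiHat_mem_of_forall_Phi_mem {𝓕 : Set (Set A)} {G : Set (Set (Set A))}
    (hG : IsMFilter (MSet 𝓕) G) (B : Finset A) (h : ∀ b ∈ B, Phi 𝓕 b ∈ G) :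
    PhiHat 𝓕 ↑B ∈ G := by
  obtain ⟨hsub, ⟨U, hU⟩, hup, hinter⟩ := hG
  induction B using Finset.induction_on with
  | empty =>
    obtain ⟨C, rfl⟩ := hsub hU
    exact hup _ hU _ ⟨∅, rfl⟩ fun P hP => ⟨hP.1, by simp⟩
  | insert b B _ ih =>
    rw [Finset.coe_insert, Set.insert_eq, PhiHat_union, ← Phi_eq_PhiHat_singleton]
    exact hinter _ (h b (Finset.mem_insert_self b B)) _
      (ih fun c hc => h c (Finset.mem_insert_of_mem hc))

open Classical in
theorem isMFilter_setOf_PhiHat_subset (𝓕 : Set (Set A)) (X : Set A) :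
    IsMFilter (MSet 𝓕)
      {U | U ∈ MSet 𝓕 ∧ ∃ C : Finset A, ↑C ⊆ X ∧ PhiHat 𝓕 ↑C ⊆ U} := by
  refine ⟨fun U hU => hU.1, ⟨PhiHat 𝓕 ↑(∅ : Finset A), ⟨∅, rfl⟩, ∅, by simp, subset_rfl⟩,
    ?_, ?_⟩
  · rintro U ⟨-, C, hC, hCU⟩ V hV hUV
    exact ⟨hV, C, hC, hCU.trans hUV⟩
  · rintro U ⟨hU, C, hC, hCU⟩ V ⟨hV, D, hD, hDV⟩
    refine ⟨inter_mem_MSet hU hV, C ∪ D, ?_, ?_⟩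
    · rw [Finset.coe_union]
      exact Set.union_subset hC hD
    · rw [Finset.coe_union, PhiHat_union]
      exact Set.inter_subset_inter hCU hDV

theorem MGen_image_Phi (𝓕 : Set (Set A)) (X : Set A) :
    MGen (MSet 𝓕) (Phi 𝓕 '' X) =
      {U | U ∈ MSet 𝓕 ∧ ∃ C : Finset A, ↑C ⊆ X ∧ PhiHat 𝓕 ↑C ⊆ U} := by
  apply Set.Subset.antisymm
  · refine fun U hU => hU _ ⟨isMFilter_setOf_PhiHat_subset 𝓕 X, ?_⟩
    rintro _ ⟨a, ha, rfl⟩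
    refine ⟨Phi_mem_MSet 𝓕 a, {a}, by simpa using ha, ?_⟩
    rw [Finset.coe_singleton, Phi_eq_PhiHat_singleton]
  · rintro U ⟨hU, C, hC, hCU⟩ G ⟨hG, hXG⟩
    exact hG.2.2.1 _
      (PhiHat_mem_of_forall_Phi_mem hG C fun c hc => hXG ⟨c, hC hc, rfl⟩) U hU hCU

theorem preimage_Phi_MGen {S : Logic L} {SA : AlgStr L A} {𝓕 : Set (Set A)}
    (hbase : IsClosureBase S SA 𝓕) {F₀ : Set A} (hF : IsSFilter S SA F₀) :
    {a : A | Phi 𝓕 a ∈ MGen (MSet 𝓕) (Phi 𝓕 '' F₀)} = F₀ := by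
  apply Set.Subset.antisymm
  · intro a ha
    rw [Set.mem_ofPred_eq, MGen_image_Phi] at ha
    obtain ⟨-, C, hC, hCa⟩ := ha
    exact Fg_subset hF hC (mem_Fg_of_PhiHat_subset_Phi hbase hCa)
  · exact fun a ha G hG => hG.2 ⟨a, ha, rfl⟩

open Classical in
theorem isSFilter_preimage_Phi {S : Logic L} {SA : AlgStr L A} (hfin : Finitary S)
    {𝓕 : Set (Set A)} (h𝓕 : ∀ P ∈ 𝓕, IsSFilter S SA P) {G : Set (Set (Set A))}
    (hG : IsMFilter (MSet 𝓕) G) : IsSFilter S SA {a : A | Phi 𝓕 a ∈ G} := by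
  intro h hh Γ δ hd hΓ
  obtain ⟨Γ₀, hΓ₀, hd₀⟩ := hfin Γ δ hd
  have hmem : PhiHat 𝓕 ↑(Γ₀.image h) ∈ G := by
    refine PhiHat_mem_of_forall_Phi_mem hG _ fun b hb => ?_
    obtain ⟨γ, hγ, rfl⟩ := Finset.mem_image.1 hb
    exact hΓ γ (hΓ₀ hγ)
  refine hG.2.2.1 _ hmem _ (Phi_mem_MSet 𝓕 _) ?_
  rintro P ⟨hP, hsub⟩
  exact ⟨hP, h𝓕 P hP h hh _ δ hd₀ fun γ hγ => hsub (Finset.mem_image_of_mem h hγ)⟩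

theorem MGen_preimage_Phi {𝓕 : Set (Set A)} {G : Set (Set (Set A))}
    (hG : IsMFilter (MSet 𝓕) G) :
    MGen (MSet 𝓕) (Phi 𝓕 '' {a : A | Phi 𝓕 a ∈ G}) = G := by
  apply Set.Subset.antisymm
  · refine fun U hU => hU G ⟨hG, ?_⟩
    rintro _ ⟨a, ha, rfl⟩
    exact ha
  · intro U hU
    rw [MGen_image_Phi]
    obtain ⟨B, rfl⟩ := hG.1 hU
    exact ⟨⟨B, rfl⟩, B, fun b hb => hG.2.2.1 _ hU _ (Phi_mem_MSet 𝓕 b)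
      fun P hP => ⟨hP.1, hP.2 hb⟩, subset_rfl⟩

theorem MGen_mono (MA : Set (Set (Set A))) {X Y : Set (Set (Set A))} (h : X ⊆ Y) :
    MGen MA X ⊆ MGen MA Y :=
  fun _ hU G hG => hU G ⟨hG.1, h.trans hG.2⟩

/-- For a finitary congruential logic, an `S`-algebra and an optimal `S`-base:
`F₀ ↦ ⟦φ[F₀]⟧` is a lattice isomorphism from `Fi_S(A)` onto `Fi(M(A))` with
inverse `G ↦ φ⁻¹[G]`. -/
theorem sfilters_iso_mfilters
    {L : Lang} (S : Logic L) {A : Type} (SA : AlgStr L A)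
    (hfin : Finitary S) (hcong : Congruential S) (halg : IsSAlgebra S SA)
    (𝓕 : Set (Set A)) (hbase : IsClosureBase S SA 𝓕)
    (hopt : ∀ P ∈ 𝓕, IsOptimalSFilter S SA P) :
    (∀ F₀ : Set A, IsSFilter S SA F₀ →
        IsMFilter (MSet 𝓕) (MGen (MSet 𝓕) (Phi 𝓕 '' F₀)) ∧
        {a : A | Phi 𝓕 a ∈ MGen (MSet 𝓕) (Phi 𝓕 '' F₀)} = F₀) ∧
    (∀ G : Set (Set (Set A)), IsMFilter (MSet 𝓕) G →
        IsSFilter S SA {a : A | Phi 𝓕 a ∈ G} ∧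
        MGen (MSet 𝓕) (Phi 𝓕 '' {a : A | Phi 𝓕 a ∈ G}) = G) ∧
    (∀ F₀ F₁ : Set A, IsSFilter S SA F₀ → IsSFilter S SA F₁ →
        (F₀ ⊆ F₁ ↔
          MGen (MSet 𝓕) (Phi 𝓕 '' F₀) ⊆ MGen (MSet 𝓕) (Phi 𝓕 '' F₁))) := by
  refine ⟨fun F₀ hF => ⟨?_, preimage_Phi_MGen hbase hF⟩,
    fun G hG => ⟨isSFilter_preimage_Phi hfin hbase.1 hG, MGen_preimage_Phi hG⟩,
    fun F₀ F₁ hF₀ hF₁ => ⟨fun h => MGen_mono _ (Set.image_mono h), fun h => ?_⟩⟩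
  · rw [MGen_image_Phi]
    exact isMFilter_setOf_PhiHat_subset 𝓕 F₀
  · rw [← preimage_Phi_MGen hbase hF₀, ← preimage_Phi_MGen hbase hF₁]
    exact fun a ha => h ha
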